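/- Let k be an algebraic extension of a finite field of characteristic p. Then k is torally Kummer-faithful if and only if for every prime l ≠ p, the maximal pro-l quotient of the absolute Galois group of k is isomorphic to Z_l (the l-adic integers). -/

import Mathlib

/-- The maximal pro-`l` quotient of `G` is isomorphic to `ℤ_l`: there is a continuous
surjection `φ : G → ℤ_l` through which every continuous homomorphism from `G` to a finite
(discrete) `l`-group factors. -/
def MaximalProQuotientIsoZl (G : Type) [Group G] [TopologicalSpace G] (l : ℕ)
    [Fact l.Prime] : Prop :=
  ∃ φ : G →* Multiplicative ℤ_[l], Continuous φ ∧ Function.Surjective φ ∧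
    ∀ (Q : Type) [Group Q] [TopologicalSpace Q] [DiscreteTopology Q] [Finite Q],
      IsPGroup l Q → ∀ f : G →* Q, Continuous f →
        ∃ g : Multiplicative ℤ_[l] →* Q, Continuous g ∧ ∀ x, f x = g (φ x)

/-- A field `k` is torally Kummer-faithful if for every finite extension `k'` of `k`, the
group of divisible elements of `k'ˣ` is trivial. -/
def IsTorallyKummerFaithful (k : Type) [Field k] : Prop :=
  ∀ (k' : Type) [Field k'] [Algebra k k'], FiniteDimensional k k' →
    ∀ a : k'ˣ, (∀ n : ℕ, 0 < n → ∃ b : k'ˣ, b ^ n = a) → a = 1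

set_option linter.unusedSectionVars false
section Aux
variable {p : ℕ} [Fact p.Prime] {K : Type} [Field K] [Algebra (ZMod p) K]

lemma aux_exists_deg [Algebra.IsAlgebraic (ZMod p) K] (x : K) : ∃ d : ℕ, 0 < d ∧ x ^ p ^ d = x := by
  have hx : IsIntegral (ZMod p) x := Algebra.IsIntegral.isIntegral x
  have : FiniteDimensional (ZMod p) (IntermediateField.adjoin (ZMod p) {x}) :=
    IntermediateField.adjoin.finiteDimensional hx
  have : Finite (IntermediateField.adjoin (ZMod p) {x}) := Module.finite_of_finite (ZMod p)
  refine ⟨Module.finrank (ZMod p) (IntermediateField.adjoin (ZMod p) {x}), Module.finrank_pos, ?_⟩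
  rw [FiniteField.pow_finrank_eq_natCard]
  have := Fintype.ofFinite (IntermediateField.adjoin (ZMod p) {x})
  have h := FiniteField.pow_card (⟨x, IntermediateField.mem_adjoin_simple_self _ x⟩ :
    IntermediateField.adjoin (ZMod p) {x})
  rw [Fintype.card_eq_nat_card] at h
  exact congrArg Subtype.val h

lemma aux_pow_of_dvd {M : Type*} [Monoid M] {x : M} {q d e : ℕ} (h : x ^ q ^ d = x) (hde : d ∣ e) :
    x ^ q ^ e = x := by
  obtain ⟨c, rfl⟩ := hde
  induction c with
  | zero => simp
  | succ n ih => rw [Nat.mul_succ, pow_add, pow_mul, ih, h]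

lemma aux_pow_congr {M : Type*} [Monoid M] {x : M} {q d a b : ℕ} (h : x ^ q ^ d = x)
    (hab : a ≡ b [MOD d]) : x ^ q ^ a = x ^ q ^ b := by
  have key : ∀ a, x ^ q ^ a = x ^ q ^ (a % d) := by
    intro a
    conv_lhs => rw [← Nat.mod_add_div a d, add_comm, pow_add, pow_mul,
      aux_pow_of_dvd h (dvd_mul_right _ _)]
  rw [key a, key b, hab]

lemma aux_iter {k : Type} [Field k] [Algebra k K] (σ : K ≃ₐ[k] K) {d a : ℕ} 
    (h : ∀ x : K, x ^ p ^ d = x → σ x = x ^ p ^ a) (m : ℕ) (x : K) (hx : x ^ p ^ d = x) :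
    (σ ^ m) x = x ^ p ^ (a * m) := by
  induction m with
  | zero => simp
  | succ n ih =>
    rw [pow_succ, AlgEquiv.mul_apply, h x hx, map_pow, ih, ← pow_mul, ← pow_add]; rfl

variable [IsAlgClosed K]

lemma aux_prim (n : ℕ) (hn : ¬ p ∣ n) : ∃ ζ : K, IsPrimitiveRoot ζ n := by
  have : CharP K p := charP_of_injective_algebraMap (algebraMap (ZMod p) K).injective p
  have : NeZero (n : K) := ⟨by rwa [Ne, CharP.cast_eq_zero_iff K p]⟩
  exact HasEnoughRootsOfUnity.prim

lemma aux_not_dvd (d : ℕ) (hd : 0 < d) : ¬ p ∣ p ^ d - 1 := by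
  have hp : p.Prime := Fact.out
  intro h
  have h1 : p ∣ p ^ d := dvd_pow_self _ hd.ne'
  have h2 : 1 ≤ p ^ d := Nat.one_le_pow _ _ hp.pos
  have := (Nat.dvd_sub_iff_right h2 h1).1 h
  exact hp.one_lt.ne' (Nat.dvd_one.1 this)

lemma aux_gen (K : Type) [Field K] [Algebra (ZMod p) K] [IsAlgClosed K] (d : ℕ) (hd : 0 < d) :
    ∃ ζ : K, IsPrimitiveRoot ζ (p ^ d - 1) ∧ ζ ^ p ^ d = ζ ∧
    ∀ x : K, x ^ p ^ d = x → x = 0 ∨ ∃ i, x = ζ ^ i := by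
  have hp : p.Prime := Fact.out
  obtain ⟨ζ, hζ⟩ := aux_prim (K := K) (p ^ d - 1) (aux_not_dvd d hd)
  have h1 : 1 < p ^ d := Nat.one_lt_pow hd.ne' hp.one_lt
  have h2 : p ^ d = (p ^ d - 1) + 1 := by omega
  refine ⟨ζ, hζ, ?_, fun x hx => ?_⟩
  · rw [h2, pow_succ, hζ.pow_eq_one, one_mul]
  · by_cases h0 : x = 0
    · exact .inl h0
    · right
      rw [h2, pow_succ] at hx
      have := mul_eq_right₀ h0 |>.1 hx
      have : NeZero (p ^ d - 1) := ⟨by omega⟩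
      obtain ⟨i, -, hi⟩ := hζ.eq_pow_of_pow_eq_one ‹x ^ _ = 1›
      exact ⟨i, hi.symm⟩

lemma aux_frob (σ : K ≃ₐ[ZMod p] K) (d : ℕ) (hd : 0 < d) [Algebra.IsAlgebraic (ZMod p) K] :
    ∃ a : ℕ, ∀ x : K, x ^ p ^ d = x → σ x = x ^ p ^ a := by
  have hp : p.Prime := Fact.out
  obtain ⟨ζ, hζ, -, hx⟩ := aux_gen (p := p) K d hd
  have hi : IsIntegral (ZMod p) ζ := Algebra.IsIntegral.isIntegral ζ
  let E := IntermediateField.adjoin (ZMod p) {ζ}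
  have : FiniteDimensional (ZMod p) E := IntermediateField.adjoin.finiteDimensional hi
  have : Finite E := Module.finite_of_finite (ZMod p)
  obtain ⟨a, ha⟩ := (FiniteField.bijective_frobeniusAlgEquivOfAlgebraic_pow (ZMod p) E).2
    (σ.restrictNormal E)
  have h1 := AlgEquiv.restrictNormal_commutes σ E ⟨ζ, IntermediateField.mem_adjoin_simple_self _ ζ⟩
  simp only [← ha, AlgEquiv.coe_pow, FiniteField.coe_frobeniusAlgEquivOfAlgebraic_iterate] at h1
  have h2 : σ ζ = ζ ^ p ^ (a : ℕ) := by
    rw [ZMod.card] at h1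
    exact h1.symm
  refine ⟨a, fun x h => ?_⟩
  rcases hx x h with rfl | ⟨i, rfl⟩
  · rw [map_zero, zero_pow (pow_ne_zero _ hp.ne_zero)]
  · rw [map_pow, h2, ← pow_mul, ← pow_mul, mul_comm]

lemma aux_frob' {k : Type} [Field k] [Algebra k K] [Algebra (ZMod p) k] [IsScalarTower (ZMod p) k K]
    (σ : K ≃ₐ[k] K) (d : ℕ) (hd : 0 < d) [Algebra.IsAlgebraic (ZMod p) K] :
    ∃ a : ℕ, ∀ x : K, x ^ p ^ d = x → σ x = x ^ p ^ a :=
  aux_frob (σ.restrictScalars (ZMod p)) d hd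

lemma aux_modEq (K : Type) [Field K] [Algebra (ZMod p) K] [IsAlgClosed K] {d a b : ℕ} (hd : 0 < d)
    (h : ∀ x : K, x ^ p ^ d = x → x ^ p ^ a = x ^ p ^ b) :
    a ≡ b [MOD d] := by
  have hp : p.Prime := Fact.out
  obtain ⟨ζ, hζ, h1, -⟩ := aux_gen (p := p) K d hd
  have h2 : ζ ^ p ^ (a % d) = ζ ^ p ^ (b % d) := by
    rw [aux_pow_congr h1 (Nat.mod_modEq a d), aux_pow_congr h1 (Nat.mod_modEq b d), h ζ h1]
  have hpd := Nat.one_lt_pow hd.ne' hp.one_lt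
  by_cases hsp : d = 1
  · subst hsp; exact Nat.modEq_one
  have lt : ∀ a, p ^ (a % d) < p ^ d - 1 := by
    intro a
    have h3 : p ^ (a % d) ≤ p ^ (d - 1) :=
      Nat.pow_le_pow_right hp.pos (by have := Nat.mod_lt a hd; omega)
    have h4 : p ^ d = p ^ (d-1) * p := by rw [← pow_succ]; congr; omega
    have h5 : 2 ≤ p ^ (d-1) := hp.two_le.trans (Nat.le_self_pow (by omega) _)
    have := hp.two_le
    have : p ^ (d-1) * 2 ≤ p ^ (d-1) * p := Nat.mul_le_mul_left _ this
    omega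
  have := hζ.pow_inj (lt a) (lt b) h2
  exact Nat.pow_right_injective hp.two_le this

lemma aux_key (l : ℕ) [Fact l.Prime] [Algebra.IsAlgebraic (ZMod p) K] {k : Type} [Field k]
    [Algebra k K] [Algebra (ZMod p) k] [IsScalarTower (ZMod p) k K] (σ : K ≃ₐ[k] K)
    (h : ∀ (N : ℕ) (x : K), x ^ p ^ (l ^ N) = x → σ x = x) (d : ℕ) (hd : 0 < d) :
    ∃ m, ¬ l ∣ m ∧ ∀ x : K, x ^ p ^ d = x → (σ ^ m) x = x := by
  have hl : l.Prime := Fact.out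
  obtain ⟨N, m, hm, rfl⟩ := Nat.exists_eq_pow_mul_and_not_dvd hd.ne' l hl.ne_one
  obtain ⟨a, ha⟩ := aux_frob' (p := p) σ _ hd
  refine ⟨m, hm, fun x hx => ?_⟩
  rw [aux_iter σ ha m x hx]
  have : a ≡ 0 [MOD l ^ N] := aux_modEq (p := p) K (pow_pos hl.pos _) fun x hx => by
    rw [← ha x (aux_pow_of_dvd hx (dvd_mul_right _ _)), h N x hx]; simp
  rw [Nat.modEq_zero_iff_dvd] at this
  exact aux_pow_of_dvd hx (mul_dvd_mul_right this m)

lemma aux_nt (l : ℕ) [Fact l.Prime] (hlp : l ≠ p) (N : ℕ) :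
    ∃ M, 0 < M ∧ ∀ a, p ^ a ≡ 1 [MOD l ^ M] → l ^ N ∣ a := by
  have hp : p.Prime := Fact.out
  have hl : l.Prime := Fact.out
  have hl1 := hl.two_le
  set C := l ^ N * (l - 1) with hC
  have hCpos : 0 < C := Nat.mul_pos (pow_pos hl.pos _) (by omega)
  refine ⟨p ^ C, pow_pos hp.pos _, fun a ha => ?_⟩
  have hbig : p ^ C < l ^ (p ^ C) := Nat.lt_pow_self hl.one_lt
  set M := p ^ C
  have hM : 0 < M := pow_pos hp.pos _
  have hcop : Nat.Coprime p (l ^ M) :=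
    Nat.Coprime.pow_right _ ((Nat.coprime_primes hp hl).2 hlp.symm)
  have htot := Nat.ModEq.pow_totient hcop
  rw [Nat.totient_prime_pow hl hM] at htot
  set e := orderOf ((p : ZMod (l ^ M)))
  have e1 : ∀ a, p ^ a ≡ 1 [MOD l ^ M] ↔ e ∣ a := by
    intro a
    rw [orderOf_dvd_iff_pow_eq_one, ← ZMod.natCast_eq_natCast_iff]
    push_cast; rfl
  refine dvd_trans ?_ ((e1 a).1 ha)
  have h2 := (e1 _).1 htot
  obtain ⟨e₁, e₂, h₁, h₂, he⟩ := (Nat.dvd_mul).1 h2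
  obtain ⟨j, hj, rfl⟩ := (Nat.dvd_prime_pow hl).1 h₁
  by_cases hjN : N ≤ j
  · rw [← he]; exact dvd_mul_of_dvd_left (pow_dvd_pow _ hjN) _
  · exfalso
    have h3 : e ∣ C := by
      rw [← he, hC]; exact mul_dvd_mul (pow_dvd_pow _ (by omega)) h₂
    have h4 := (e1 _).2 h3
    have h5 : 1 < p ^ C := Nat.one_lt_pow hCpos.ne' hp.one_lt
    have := Nat.ModEq.eq_of_lt_of_lt h4 hbig (h5.trans hbig)
    omega

lemma aux_fix_of_roots (l : ℕ) [Fact l.Prime] (hlp : l ≠ p) [Algebra.IsAlgebraic (ZMod p) K] {k : Type} [Field k]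
    [Algebra k K] [Algebra (ZMod p) k] [IsScalarTower (ZMod p) k K] (σ : K ≃ₐ[k] K) (h : ∀ (M : ℕ) (x : K), x ^ l ^ M = 1 → σ x = x) (N : ℕ) (x : K)
    (hx : x ^ p ^ (l ^ N) = x) : σ x = x := by
  have hp : p.Prime := Fact.out
  have hl : l.Prime := Fact.out
  obtain ⟨M, hM, hMN⟩ := aux_nt (p := p) l hlp N
  obtain ⟨ζ, hζ⟩ := aux_prim (p := p) (K := K) (l ^ M)
    (fun h => hlp ((Nat.prime_dvd_prime_iff_eq hp hl).1 (hp.dvd_of_dvd_pow h)).symm)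
  obtain ⟨e, he, hζe⟩ := aux_exists_deg (p := p) ζ
  obtain ⟨a, ha⟩ := aux_frob' (p := p) σ (l ^ N * e) (Nat.mul_pos (pow_pos hl.pos _) he)
  have h1 := ha ζ (aux_pow_of_dvd hζe (dvd_mul_left _ _))
  rw [h M ζ hζ.pow_eq_one] at h1
  have h2 : p ^ a ≡ 1 [MOD l ^ M] := by
    have h0 : ζ ≠ 0 := hζ.ne_zero (pow_pos hl.pos _).ne'
    have h3 : 1 ≤ p ^ a := Nat.one_le_pow _ _ hp.pos
    refine ((Nat.modEq_iff_dvd' h3).2 (hζ.dvd_of_pow_eq_one _ ?_)).symm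
    apply mul_right_cancel₀ h0
    rw [← pow_succ, Nat.sub_add_cancel h3, ← h1, one_mul]
  rw [ha x (aux_pow_of_dvd hx (dvd_mul_right _ _))]
  exact aux_pow_of_dvd hx (hMN a h2)

lemma aux_fd [Algebra.IsAlgebraic (ZMod p) K] {k : Type} [Field k]
    [Algebra k K] {k' : Type} [Field k'] [Algebra k k'] [FiniteDimensional k k'] (j : k' →ₐ[k] K) :
    ∃ d, 0 < d ∧ ∀ σ : K ≃ₐ[k] K, (∀ x : K, x ^ p ^ d = x → σ x = x) → ∀ y, σ (j y) = j y := by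
  let b := Module.finBasis k k'
  choose d hd h using fun i => aux_exists_deg (p := p) (j (b i))
  refine ⟨∏ i, d i, Finset.prod_pos fun i _ => hd i, fun σ hσ => ?_⟩
  have : σ.toLinearMap ∘ₗ j.toLinearMap = j.toLinearMap := b.ext fun i => 
    hσ _ (aux_pow_of_dvd (h i) (Finset.dvd_prod_of_mem d (Finset.mem_univ i)))
  exact fun y => congrArg (fun f => f y) this

variable {k : Type} [Field k] [Algebra k K] [Algebra (ZMod p) k] [IsScalarTower (ZMod p) k K]
  [Algebra.IsAlgebraic (ZMod p) K]

lemma aux_open (l : ℕ) [Fact l.Prime] (H : Subgroup (K ≃ₐ[k] K)) (hH : IsOpen (H : Set (K ≃ₐ[k] K)))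
    (σ : K ≃ₐ[k] K) (h : ∀ (N : ℕ) (x : K), x ^ p ^ (l ^ N) = x → σ x = x) :
    ∃ m, ¬ l ∣ m ∧ σ ^ m ∈ H := by
  obtain ⟨E, hE, hEH⟩ := (krullTopology_mem_nhds_one_iff k K H).1 (hH.mem_nhds H.one_mem)
  obtain ⟨d, hd, hdE⟩ := aux_fd (p := p) E.val
  obtain ⟨m, hm, hmx⟩ := aux_key l σ h d hd
  refine ⟨m, hm, hEH ?_⟩
  rw [SetLike.mem_coe, IntermediateField.mem_fixingSubgroup_iff]
  exact fun x hx => hdE _ hmx ⟨x, hx⟩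

lemma aux_hom_zero (l : ℕ) [Fact l.Prime] (φ : (K ≃ₐ[k] K) →* Multiplicative ℤ_[l])
    (hφ : Continuous φ)
    (σ : K ≃ₐ[k] K) (h : ∀ (N : ℕ) (x : K), x ^ p ^ (l ^ N) = x → σ x = x) : φ σ = 1 := by
  have hl : l.Prime := Fact.out
  have hc : Continuous fun σ => (φ σ).toAdd := continuous_toAdd.comp hφ
  suffices hs : ∀ n : ℕ, PadicInt.toZModPow n (φ σ).toAdd = PadicInt.toZModPow n 0 from
    Multiplicative.toAdd.injective (PadicInt.ext_of_toZModPow.1 hs)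
  intro n
  let ψ : (K ≃ₐ[k] K) →* Multiplicative (ZMod (l ^ n)) :=
    (AddMonoidHom.toMultiplicative (PadicInt.toZModPow (p := l) n).toAddMonoidHom).comp φ
  have hψ : ∀ τ, ψ τ = 1 ↔ (φ τ).toAdd ∈ Ideal.span {(l : ℤ_[l]) ^ n} := by
    intro τ
    rw [← PadicInt.ker_toZModPow]; rfl
  have hopen : IsOpen (ψ.ker : Set (K ≃ₐ[k] K)) := by
    have : (ψ.ker : Set (K ≃ₐ[k] K)) =
        (fun σ => (φ σ).toAdd) ⁻¹' (Metric.closedBall 0 ((l : ℝ) ^ (-n : ℤ))) := by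
      ext τ
      simp only [SetLike.mem_coe, MonoidHom.mem_ker, Set.mem_preimage, mem_closedBall_zero_iff]
      rw [hψ, PadicInt.norm_le_pow_iff_mem_span_pow]
    rw [this]
    apply IsOpen.preimage hc
    apply IsUltrametricDist.isOpen_closedBall
    have : (0 : ℝ) < l := by exact_mod_cast hl.pos
    positivity
  obtain ⟨m, hm, hmH⟩ := aux_open l ψ.ker hopen σ h
  rw [MonoidHom.mem_ker, map_pow] at hmH
  have h1 : m • (ψ σ).toAdd = 0 := hmH
  rw [map_zero]
  have h2 : (m : ZMod (l ^ n)) * (ψ σ).toAdd = 0 := by rw [← h1, nsmul_eq_mul]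
  have hu : IsUnit (m : ZMod (l ^ n)) := by
    rw [ZMod.isUnit_iff_coprime]
    exact Nat.Coprime.pow_right _ ((hl.coprime_iff_not_dvd.2 hm).symm)
  exact (hu.mul_right_eq_zero).1 h2

lemma aux_backward [Algebra.IsAlgebraic k K]
    (H : ∀ (l : ℕ) [Fact l.Prime], l ≠ p → ∃ φ : (K ≃ₐ[k] K) →* Multiplicative ℤ_[l],
      Continuous φ ∧ Function.Surjective φ)
    (k' : Type) [Field k'] [Algebra k k'] (hfd : FiniteDimensional k k') (a : k'ˣ)
    (ha : ∀ n : ℕ, 0 < n → ∃ b : k'ˣ, b ^ n = a) : a = 1 := by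
  have hp : p.Prime := Fact.out
  by_contra hne
  let j : k' →ₐ[k] K := IsAlgClosed.lift
  have : CharP K p := charP_of_injective_algebraMap (algebraMap (ZMod p) K).injective p
  have : CharP k' p := (RingHom.charP_iff j.toRingHom j.injective p).2 this
  have hfin : ∃ d, 0 < d ∧ a ^ (p ^ d - 1) = 1 := by
    obtain ⟨d, hd, h⟩ := aux_exists_deg (p := p) (j a)
    refine ⟨d, hd, ?_⟩
    have h1 : a ^ p ^ d = a := by
      apply Units.ext
      apply j.injective
      simpa using h
    have : p ^ d = (p ^ d - 1) + 1 := by have := Nat.one_le_pow d p hp.pos; omega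
    rw [this, pow_succ] at h1
    exact mul_eq_right.1 h1
  obtain ⟨d, hd, had⟩ := hfin
  obtain ⟨l, hl, hla⟩ := Nat.exists_prime_and_dvd (n := orderOf a) (by rwa [Ne, orderOf_eq_one_iff])
  have : Fact l.Prime := ⟨hl⟩
  have hlp : l ≠ p := by
    rintro rfl
    exact aux_not_dvd d hd (hla.trans (orderOf_dvd_of_pow_eq_one had))
  have ho : 0 < orderOf a := by
    rw [orderOf_pos_iff, isOfFinOrder_iff_pow_eq_one]
    refine ⟨_, ?_, had⟩
    have := Nat.one_lt_pow hd.ne' hp.one_lt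
    omega
  have hprim : ∀ M, ∃ b : k'ˣ, orderOf b = l ^ (M + 1) := by
    intro M
    obtain ⟨c, hc⟩ := hla
    have hc0 : 0 < c := Nat.pos_of_ne_zero (by rintro rfl; rw [hc] at ho; simp at ho)
    have hac : orderOf (a ^ c) = l := by
      rw [orderOf_pow_of_dvd hc0.ne' ⟨l, by rw [hc, mul_comm]⟩, hc, Nat.mul_div_cancel _ hc0]
    obtain ⟨b, hb⟩ := ha (l ^ M) (pow_pos hl.pos _)
    refine ⟨b ^ c, orderOf_eq_prime_pow ?_ ?_⟩
    · rw [← pow_mul, mul_comm, pow_mul, hb]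
      intro h; rw [h, orderOf_one] at hac; exact hl.one_lt.ne hac
    · rw [pow_succ, pow_mul, ← pow_mul b, mul_comm c, pow_mul b, hb, ← hac, pow_orderOf_eq_one]
  obtain ⟨φ, hφ, hsurj⟩ := H l hlp
  obtain ⟨σ, hσ⟩ := hsurj (Multiplicative.ofAdd 1)
  obtain ⟨e, he, hek'⟩ := aux_fd (p := p) j
  obtain ⟨s, hs⟩ := aux_frob' (p := p) σ e he
  have h1 := hek' (σ ^ e) fun x hx => by
    rw [aux_iter σ hs e x hx]; exact aux_pow_of_dvd hx (dvd_mul_left _ _)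
  have h2 : ∀ (M : ℕ) (x : K), x ^ l ^ M = 1 → (σ ^ e) x = x := by
    intro M x hx
    obtain ⟨b, hb⟩ := hprim M
    have hb1 : IsPrimitiveRoot (j b) (l ^ (M + 1)) := by
      have h := IsPrimitiveRoot.orderOf b
      rw [hb] at h
      exact (IsPrimitiveRoot.coe_units_iff.2 h).map_of_injective j.injective
    have : NeZero (l ^ (M + 1)) := ⟨(pow_pos hl.pos _).ne'⟩
    obtain ⟨i, -, rfl⟩ := hb1.eq_pow_of_pow_eq_one (ξ := x) (by rw [pow_succ, pow_mul, hx, one_pow])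
    rw [map_pow, h1]
  have h3 := aux_hom_zero l φ hφ (σ ^ e) (aux_fix_of_roots l hlp _ h2)
  rw [map_pow, hσ, ← ofAdd_nsmul, ofAdd_eq_one, nsmul_one] at h3
  exact he.ne' (by exact_mod_cast h3)


lemma aux_padic_exists (l : ℕ) [Fact l.Prime] (σ : K ≃ₐ[k] K) :
    ∃ z : ℤ_[l], ∀ (n a : ℕ), PadicInt.toZModPow n z = (a : ZMod (l ^ n)) →
      ∀ x : K, x ^ p ^ (l ^ n) = x → σ x = x ^ p ^ a := by
  have hl : l.Prime := Fact.out
  choose a ha using fun n : ℕ => aux_frob' (p := p) σ (l ^ n) (pow_pos hl.pos n)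
  have hi : ∀ i, (l : ℤ) ^ i ∣ (a (i + 1) : ℤ) - (a i : ℤ) := by
    intro i
    have : a i ≡ a (i + 1) [MOD l ^ i] := aux_modEq (p := p) K (pow_pos hl.pos i) fun x hx => by
      rw [← ha i x hx, ← ha (i + 1) x (aux_pow_of_dvd hx (pow_dvd_pow _ (Nat.le_succ i)))]
    exact_mod_cast (Nat.modEq_iff_dvd.1 this)
  have hT := PadicInt.toZModPow_ofIntSeq_of_pow_dvd_sub (fun n => (a n : ℤ)) l hi
  refine ⟨PadicInt.ofIntSeq _ (PadicInt.isCauSeq_padicNorm_of_pow_dvd_sub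
    (fun n => (a n : ℤ)) l hi), fun n b hb x hx => ?_⟩
  · rw [hT n] at hb
    rw [ha n x hx]
    refine aux_pow_congr hx ?_
    rw [← ZMod.natCast_eq_natCast_iff]
    exact_mod_cast hb

lemma aux_padic_unique (l : ℕ) [Fact l.Prime] (σ : K ≃ₐ[k] K) (z w : ℤ_[l])
    (hz : ∀ (n a : ℕ), PadicInt.toZModPow n z = (a : ZMod (l ^ n)) →
      ∀ x : K, x ^ p ^ (l ^ n) = x → σ x = x ^ p ^ a)
    (hw : ∀ (n a : ℕ), PadicInt.toZModPow n w = (a : ZMod (l ^ n)) →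
      ∀ x : K, x ^ p ^ (l ^ n) = x → σ x = x ^ p ^ a) : z = w := by
  have hl : l.Prime := Fact.out
  refine PadicInt.ext_of_toZModPow.1 fun n => ?_
  have : NeZero (l ^ n) := ⟨(pow_pos hl.pos _).ne'⟩
  obtain ⟨a, ha⟩ := ZMod.natCast_zmod_surjective (PadicInt.toZModPow n z)
  obtain ⟨b, hb⟩ := ZMod.natCast_zmod_surjective (PadicInt.toZModPow n w)
  rw [← ha, ← hb, ZMod.natCast_eq_natCast_iff]
  refine aux_modEq (p := p) K (pow_pos hl.pos n) fun x hx => ?_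
  rw [← hz n a ha.symm x hx, ← hw n b hb.symm x hx]

lemma aux_psi (p : ℕ) [Fact p.Prime] (k K : Type) [Field K] [Algebra (ZMod p) K] [IsAlgClosed K]
    [Field k] [Algebra k K] [Algebra (ZMod p) k] [IsScalarTower (ZMod p) k K]
    [Algebra.IsAlgebraic (ZMod p) K] (l : ℕ) [Fact l.Prime] :
    ∃ ψ : (K ≃ₐ[k] K) →* Multiplicative ℤ_[l], ∀ (σ : K ≃ₐ[k] K) (n a : ℕ),
      PadicInt.toZModPow n (ψ σ).toAdd = (a : ZMod (l ^ n)) →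
      ∀ x : K, x ^ p ^ (l ^ n) = x → σ x = x ^ p ^ a := by
  have hl : l.Prime := Fact.out
  choose z hz using fun σ : K ≃ₐ[k] K => aux_padic_exists (p := p) l σ
  refine ⟨MonoidHom.mk' (fun σ => Multiplicative.ofAdd (z σ)) fun σ τ => ?_, hz⟩
  rw [← ofAdd_add]
  congr 1
  refine aux_padic_unique l (σ * τ) _ _ (hz _) fun n a ha x hx => ?_
  have : NeZero (l ^ n) := ⟨(pow_pos hl.pos _).ne'⟩
  obtain ⟨b, hb⟩ := ZMod.natCast_zmod_surjective (PadicInt.toZModPow n (z σ))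
  obtain ⟨c, hc⟩ := ZMod.natCast_zmod_surjective (PadicInt.toZModPow n (z τ))
  rw [AlgEquiv.mul_apply, hz τ n c hc.symm x hx, map_pow, hz σ n b hb.symm x hx, ← pow_mul,
    ← pow_add]
  refine aux_pow_congr hx ?_
  rw [← ZMod.natCast_eq_natCast_iff, ← ha, map_add, ← hb, ← hc]
  push_cast; rfl

lemma aux_psi_cont (l : ℕ) [Fact l.Prime] [Algebra.IsAlgebraic k K]
    (ψ : (K ≃ₐ[k] K) →* Multiplicative ℤ_[l])
    (hψ : ∀ (σ : K ≃ₐ[k] K) (n a : ℕ),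
      PadicInt.toZModPow n (ψ σ).toAdd = (a : ZMod (l ^ n)) →
      ∀ x : K, x ^ p ^ (l ^ n) = x → σ x = x ^ p ^ a) : Continuous ψ := by
  have hl : l.Prime := Fact.out
  refine continuous_of_continuousAt_one ψ ?_
  rw [ContinuousAt, map_one]
  suffices h : Filter.Tendsto (fun σ => (ψ σ).toAdd) (nhds 1) (nhds 0) from
    (continuous_ofAdd.tendsto (0 : ℤ_[l])).comp h
  rw [Metric.nhds_basis_closedBall.tendsto_right_iff]
  intro ε hε
  obtain ⟨n, hn⟩ := PadicInt.exists_pow_neg_lt l hε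
  obtain ⟨ζ, -, hζ, hgen⟩ := aux_gen (p := p) K (l ^ n) (pow_pos hl.pos n)
  have hmem : ((IntermediateField.adjoin k {ζ}).fixingSubgroup : Set (K ≃ₐ[k] K)) ∈ nhds (1 : K ≃ₐ[k] K) := by
    have : FiniteDimensional k (IntermediateField.adjoin k {ζ}) :=
      IntermediateField.adjoin.finiteDimensional (Algebra.IsIntegral.isIntegral ζ)
    exact (IntermediateField.fixingSubgroup_isOpen _).mem_nhds (Subgroup.one_mem _)
  filter_upwards [hmem] with σ hσ
  rw [SetLike.mem_coe, IntermediateField.mem_fixingSubgroup_iff] at hσ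
  have hσζ := hσ ζ (IntermediateField.mem_adjoin_simple_self _ ζ)
  rw [mem_closedBall_zero_iff]
  refine le_trans ?_ hn.le
  rw [PadicInt.norm_le_pow_iff_mem_span_pow, ← PadicInt.ker_toZModPow, RingHom.mem_ker]
  have : NeZero (l ^ n) := ⟨(pow_pos hl.pos _).ne'⟩
  obtain ⟨a, ha⟩ := ZMod.natCast_zmod_surjective (PadicInt.toZModPow n (ψ σ).toAdd)
  rw [← ha, ← Nat.cast_zero, ZMod.natCast_eq_natCast_iff]
  refine aux_modEq (p := p) K (pow_pos hl.pos n) fun x hx => ?_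
  rw [← hψ σ n a ha.symm x hx]
  rcases hgen x hx with rfl | ⟨i, rfl⟩
  · simp
  · rw [map_pow, hσζ]; simp

lemma aux_not_all_fixed (l : ℕ) [Fact l.Prime] (hlp : l ≠ p) [IsGalois k K]
    (hT : IsTorallyKummerFaithful k)
    (h : ∀ (σ : K ≃ₐ[k] K) (N : ℕ) (x : K), x ^ p ^ (l ^ N) = x → σ x = x) : False := by
  have hl : l.Prime := Fact.out
  have hp : p.Prime := Fact.out
  have hl2 := hl.two_le
  obtain ⟨ζ, -, hζ, hgen⟩ := aux_gen (p := p) K (l - 1) (by omega)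
  let E := IntermediateField.adjoin k {ζ}
  have hfd : FiniteDimensional k E :=
      IntermediateField.adjoin.finiteDimensional (Algebra.IsIntegral.isIntegral ζ)
  have hmu : ∀ (M : ℕ) (x : K), x ^ l ^ (M + 1) = 1 → x ∈ E := by
    intro M x hx
    rw [← InfiniteGalois.fixedField_fixingSubgroup E, IntermediateField.mem_fixedField_iff]
    intro σ hσ
    rw [IntermediateField.mem_fixingSubgroup_iff] at hσ
    have hσζ := hσ ζ (IntermediateField.mem_adjoin_simple_self _ ζ)
    have hlM : 0 < l ^ M := pow_pos hl.pos M
    obtain ⟨a, ha⟩ := aux_frob' (p := p) σ (l ^ M * (l - 1)) (Nat.mul_pos hlM (by omega))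
    have h1 : a ≡ 0 [MOD l ^ M] := aux_modEq (p := p) K hlM fun x hx => by
      rw [← ha x (aux_pow_of_dvd hx (dvd_mul_right _ _)), h σ M x hx]; simp
    have h2 : a ≡ 0 [MOD l - 1] := aux_modEq (p := p) K (by omega) fun x hx => by
      rw [← ha x (aux_pow_of_dvd hx (dvd_mul_left _ _))]
      rcases hgen x hx with rfl | ⟨i, rfl⟩
      · simp
      · rw [map_pow, hσζ]; simp
    rw [Nat.modEq_zero_iff_dvd] at h1 h2
    have hcop : Nat.Coprime (l ^ M) (l - 1) := by
      apply Nat.Coprime.pow_left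
      rw [hl.coprime_iff_not_dvd]
      intro hd
      have := Nat.le_of_dvd (by omega) hd
      omega
    have h3 := hcop.mul_dvd_of_dvd_of_dvd h1 h2
    have hx1 : x ^ p ^ (l ^ M * (l - 1)) = x := by
      have hc : Nat.Coprime p (l ^ (M + 1)) :=
        Nat.Coprime.pow_right _ ((Nat.coprime_primes hp hl).2 hlp.symm)
      have ht := Nat.ModEq.pow_totient hc
      rw [Nat.totient_prime_pow hl (Nat.succ_pos M), Nat.succ_sub_one] at ht
      have h4 : 1 ≤ p ^ (l ^ M * (l - 1)) := Nat.one_le_pow _ _ hp.pos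
      obtain ⟨c, hc⟩ := (Nat.modEq_iff_dvd' h4).1 ht.symm
      have h5 : p ^ (l ^ M * (l - 1)) = l ^ (M + 1) * c + 1 := by omega
      rw [h5, pow_succ, pow_mul, hx, one_pow, one_mul]
    rw [ha x hx1]
    exact aux_pow_of_dvd hx1 h3
  have hprim : ∀ n, ∃ ζ : K, IsPrimitiveRoot ζ (l ^ n) := fun n => 
    aux_prim (p := p) (K := K) (l ^ n)
      (fun h => hlp ((Nat.prime_dvd_prime_iff_eq hp hl).1 (hp.dvd_of_dvd_pow h)).symm)
  obtain ⟨ξ, hξ⟩ := hprim 1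
  rw [pow_one] at hξ
  have hξ0 : ξ ≠ 0 := hξ.ne_zero hl.ne_zero
  have hξE : ξ ∈ E := hmu 0 ξ (by rw [zero_add, pow_one, hξ.pow_eq_one])
  let a : Eˣ := Units.mk0 ⟨ξ, hξE⟩ (fun h => hξ0 (congrArg Subtype.val h))
  have ha := hT E hfd a fun n hn => by
    obtain ⟨r, m, hm, rfl⟩ := Nat.exists_eq_pow_mul_and_not_dvd hn.ne' l hl.ne_one
    obtain ⟨m', -, hm'⟩ := Nat.exists_mul_mod_eq_one_of_coprime
      (hl.coprime_iff_not_dvd.2 hm).symm hl.one_lt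
    obtain ⟨y, hy⟩ := IsAlgClosed.exists_pow_nat_eq ξ (pow_pos hl.pos r)
    have hy0 : y ≠ 0 := by
      rintro rfl
      rw [zero_pow (pow_pos hl.pos r).ne'] at hy
      exact hξ0 hy.symm
    have hyE : y ∈ E := hmu r y (by rw [pow_succ, pow_mul, hy, hξ.pow_eq_one])
    let b : Eˣ := Units.mk0 ⟨y, hyE⟩ (fun h => hy0 (congrArg Subtype.val h))
    refine ⟨b ^ m', Units.ext (Subtype.ext ?_)⟩
    change (y ^ m') ^ (l ^ r * m) = ξ
    rw [← pow_mul, mul_left_comm, pow_mul, hy, mul_comm m', ← Nat.mod_add_div (m * m') l, hm',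
      pow_add, pow_mul, hξ.pow_eq_one, one_pow, pow_one, mul_one]
  have : ξ = 1 := congrArg (fun u : Eˣ => ((u : E) : K)) ha
  exact hξ.ne_one hl.one_lt this

lemma aux_forward (p : ℕ) [Fact p.Prime] (k K : Type) [Field K] [Algebra (ZMod p) K] [IsAlgClosed K]
    [Field k] [Algebra k K] [Algebra (ZMod p) k] [IsScalarTower (ZMod p) k K]
    [Algebra.IsAlgebraic (ZMod p) K] [IsGalois k K] (l : ℕ) [Fact l.Prime] (hlp : l ≠ p) 
    (hT : IsTorallyKummerFaithful k) : MaximalProQuotientIsoZl (K ≃ₐ[k] K) l := by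
  have hl : l.Prime := Fact.out
  obtain ⟨ψ, hψ⟩ := aux_psi p k K l
  have hψc := aux_psi_cont l ψ hψ
  have hker : ∀ σ, ψ σ = 1 → ∀ (N : ℕ) (x : K), x ^ p ^ (l ^ N) = x → σ x = x := by
    intro σ hσ N x hx
    have := hψ σ N 0 (by rw [hσ]; simp) x hx
    simpa using this
  have hne : ∃ σ, (ψ σ).toAdd ≠ 0 := by
    by_contra! hcon
    exact aux_not_all_fixed l hlp hT fun σ => hker σ (hcon σ)
  obtain ⟨σ₀, hσ₀, hmin⟩ : ∃ σ₀, (ψ σ₀).toAdd ≠ 0 ∧ ∀ σ, (ψ σ₀).toAdd ∣ (ψ σ).toAdd := by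
    classical
    have hex : ∃ v : ℕ, ∃ σ, (ψ σ).toAdd ≠ 0 ∧ (ψ σ).toAdd.valuation = v := by
      obtain ⟨σ, h⟩ := hne
      exact ⟨_, σ, h, rfl⟩
    obtain ⟨σ₀, h0, hv⟩ := Nat.find_spec hex
    refine ⟨σ₀, h0, fun σ => ?_⟩
    by_cases hs : (ψ σ).toAdd = 0
    · rw [hs]; exact dvd_zero _
    · have hle := Nat.find_min' hex ⟨σ, hs, rfl⟩
      rw [← hv] at hle
      have h1 : (ψ σ).toAdd ∈ Ideal.span {(l : ℤ_[l]) ^ (ψ σ₀).toAdd.valuation} :=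
        (PadicInt.mem_span_pow_iff_le_valuation _ hs _).2 hle
      rw [Ideal.mem_span_singleton] at h1
      refine dvd_trans ?_ h1
      conv_lhs => rw [PadicInt.unitCoeff_spec h0]
      exact (Units.mul_left_dvd).2 dvd_rfl
  set z₀ := (ψ σ₀).toAdd with hz₀
  choose y hy using hmin
  let φ : (K ≃ₐ[k] K) →* Multiplicative ℤ_[l] :=
    MonoidHom.mk' (fun σ => Multiplicative.ofAdd (y σ)) fun σ τ => by
      rw [← ofAdd_add]
      congr 1
      apply mul_left_cancel₀ hσ₀
      rw [← hy, mul_add, ← hy, ← hy, map_mul, toAdd_mul]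
  have hφy : ∀ σ, (φ σ).toAdd = y σ := fun σ => rfl
  have hemb : Topology.IsClosedEmbedding (fun x : ℤ_[l] => z₀ * x) :=
    Continuous.isClosedEmbedding (by fun_prop) (mul_right_injective₀ hσ₀)
  have hyc : Continuous y := by
    rw [hemb.isInducing.continuous_iff]
    have : (fun x => z₀ * x) ∘ y = fun σ => (ψ σ).toAdd := funext fun σ => (hy σ).symm
    rw [this]
    exact continuous_toAdd.comp hψc
  have hφc : Continuous φ := continuous_ofAdd.comp hyc
  have hy1 : y σ₀ = 1 := by
    apply mul_left_cancel₀ hσ₀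
    rw [← hy, mul_one]
  have hysurj : Function.Surjective y := by
    rw [← Set.range_eq_univ]
    have hcl : IsClosed (Set.range y) := (isCompact_range hyc).isClosed
    rw [← hcl.closure_eq, ← dense_iff_closure_eq]
    refine Dense.mono ?_ (PadicInt.denseRange_natCast (p := l))
    rintro _ ⟨n, rfl⟩
    refine ⟨σ₀ ^ n, ?_⟩
    rw [← hφy, map_pow, toAdd_pow, hφy, hy1, nsmul_one]
  have hφs : Function.Surjective φ := fun z => by
    obtain ⟨σ, hσ⟩ := hysurj z.toAdd
    exact ⟨σ, congrArg Multiplicative.ofAdd hσ⟩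
  refine ⟨φ, hφc, hφs, ?_⟩
  intro Q _ _ _ _ hQ f hf
  have hk : φ.ker ≤ f.ker := by
    intro σ hσ
    rw [MonoidHom.mem_ker] at hσ ⊢
    have h1 : ψ σ = 1 := by
      have h2 : y σ = 0 := congrArg Multiplicative.toAdd hσ
      have h3 := hy σ
      rw [h2, mul_zero] at h3
      exact Multiplicative.toAdd.injective h3
    have hopen : IsOpen (f.ker : Set (K ≃ₐ[k] K)) :=
      (isOpen_discrete ({1} : Set Q)).preimage hf
    obtain ⟨m, hm, hmf⟩ := aux_open l f.ker hopen σ (hker σ h1)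
    rw [MonoidHom.mem_ker, map_pow] at hmf
    obtain ⟨n, hn⟩ := hQ (f σ)
    have hc : Nat.Coprime m (l ^ n) :=
      Nat.Coprime.pow_right _ (hl.coprime_iff_not_dvd.2 hm).symm
    have := Nat.dvd_gcd (orderOf_dvd_of_pow_eq_one hmf) (orderOf_dvd_of_pow_eq_one hn)
    rw [hc.gcd_eq_one, Nat.dvd_one, orderOf_eq_one_iff] at this
    exact this
  let g := MonoidHom.liftOfSurjective φ hφs ⟨f, hk⟩
  have hg : ∀ x, g (φ x) = f x := fun x => MonoidHom.liftOfRightInverse_comp_apply φ _ _ ⟨f, hk⟩ x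
  refine ⟨g, ?_, fun x => (hg x).symm⟩
  have hq : Topology.IsQuotientMap φ := Topology.IsQuotientMap.of_surjective_continuous hφs hφc
  rw [hq.continuous_iff]
  have : g ∘ φ = f := funext hg
  rw [this]; exact hf

end Aux

/-- Let `k` be an algebraic extension of a finite field of characteristic `p`.  Then `k` is
torally Kummer-faithful if and only if for every prime `l ≠ p`, the maximal pro-`l`
quotient of the absolute Galois group of `k` is isomorphic to `ℤ_l`. -/
theorem torallyKummerFaithful_iff_pro_l_quotients_iso_Zl
    (p : ℕ) [Fact p.Prime]
    (k : Type) [Field k] [Algebra (ZMod p) k] [Algebra.IsAlgebraic (ZMod p) k] :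
    IsTorallyKummerFaithful k ↔
      ∀ (l : ℕ) [Fact l.Prime], l ≠ p →
        MaximalProQuotientIsoZl (AlgebraicClosure k ≃ₐ[k] AlgebraicClosure k) l := by
  have : Algebra.IsAlgebraic (ZMod p) (AlgebraicClosure k) :=
    Algebra.IsAlgebraic.trans (ZMod p) k (AlgebraicClosure k)
  have : PerfectField k := Algebra.IsAlgebraic.perfectField (K := ZMod p)
  have : IsGalois k (AlgebraicClosure k) := {}
  constructor
  · intro hT l _ hlp
    exact aux_forward p k (AlgebraicClosure k) l hlp hT
  · intro H k' _ _ hfd a ha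
    refine aux_backward (p := p) (K := AlgebraicClosure k) (fun l _ hlp => ?_) k' hfd a ha
    obtain ⟨φ, h1, h2, -⟩ := H l hlp
    exact ⟨φ, h1, h2⟩
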